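/- Every Lorentzian polynomial f ∈ L_n^d with d ≥ 1 is 2(1−1/d)-Rayleigh; that is, f has nonnegative coefficients and for every α ∈ ℕ^n, every i, j ∈ [n] and every x ∈ ℝ^n with nonnegative coordinates, ∂^α f(x) · ∂^{α+e_i+e_j} f(x) ≤ 2(1−1/d) · ∂^{α+e_i} f(x) · ∂^{α+e_j} f(x). -/

import Mathlib

open MvPolynomial

namespace LorentzianPaper

/-- Iterated partial derivative `∂^α f`. -/
noncomputable def pd {n : ℕ} (α : Fin n → ℕ) (f : MvPolynomial (Fin n) ℝ) :
    MvPolynomial (Fin n) ℝ :=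
  (List.finRange n).foldr (fun i g => (fun h => pderiv i h)^[α i] g) f

/-- Hessian matrix of `f` at `x`. -/
noncomputable def hess {n : ℕ} (f : MvPolynomial (Fin n) ℝ) (x : Fin n → ℝ) :
    Matrix (Fin n) (Fin n) ℝ :=
  Matrix.of fun i j => eval x (pderiv i (pderiv j f))

/-- Number of positive eigenvalues (with multiplicity) of a real symmetric matrix. -/
noncomputable def posEigCount {n : ℕ} (M : Matrix (Fin n) (Fin n) ℝ) : ℕ :=
  if h : M.IsHermitian then {i | 0 < h.eigenvalues i}.ncard else 0

/-- Homogeneous polynomials of degree `d` with all coefficients positive. -/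
def PPos (n d : ℕ) : Set (MvPolynomial (Fin n) ℝ) :=
  {f | f.IsHomogeneous d ∧ ∀ α : Fin n →₀ ℕ, (∑ i, α i) = d → 0 < f.coeff α}

/-- Strictly Lorentzian quadratics. -/
def StrictLor2 (n : ℕ) : Set (MvPolynomial (Fin n) ℝ) :=
  {f | f ∈ PPos n 2 ∧ IsUnit (hess f 0).det ∧ posEigCount (hess f 0) = 1}

/-- Strictly Lorentzian polynomials. -/
def StrictLor (n d : ℕ) : Set (MvPolynomial (Fin n) ℝ) :=
  if d ≤ 1 then PPos n d
  else {f | f ∈ PPos n d ∧ ∀ α : Fin n → ℕ, (∑ i, α i) = d - 2 → pd α f ∈ StrictLor2 n}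

noncomputable def coeffFun {n : ℕ} (f : MvPolynomial (Fin n) ℝ) : (Fin n →₀ ℕ) → ℝ :=
  fun α => f.coeff α

/-- Lorentzian polynomials: closure of the strictly Lorentzian ones in `H_n^d`. -/
def Lor (n d : ℕ) : Set (MvPolynomial (Fin n) ℝ) :=
  {f | f.IsHomogeneous d ∧ coeffFun f ∈ closure (coeffFun '' StrictLor n d)}

/-- `c`-Rayleigh polynomials. -/
def IsRayleigh {n : ℕ} (c : ℝ) (f : MvPolynomial (Fin n) ℝ) : Prop :=
  (∀ α, 0 ≤ f.coeff α) ∧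
  ∀ (α : Fin n → ℕ) (i j : Fin n) (x : Fin n → ℝ), (∀ t, 0 ≤ x t) →
    eval x (pd α f) * eval x (pd (α + Pi.single i 1 + Pi.single j 1) f) ≤
      c * eval x (pd (α + Pi.single i 1) f) * eval x (pd (α + Pi.single j 1) f)

section Aux
open Matrix

lemma quad_spectral {n : ℕ} (A : Matrix (Fin n) (Fin n) ℝ) (hA : A.IsHermitian) (z : Fin n → ℝ) :
    z ⬝ᵥ (A *ᵥ z) = ∑ k, hA.eigenvalues k * ((hA.eigenvectorBasis k).ofLp ⬝ᵥ z) ^ 2 := by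
  have hz : z = ∑ k, ((hA.eigenvectorBasis k).ofLp ⬝ᵥ z) • (hA.eigenvectorBasis k).ofLp := by
    have h := hA.eigenvectorBasis.sum_repr' (WithLp.toLp 2 z)
    have h2 := congrArg WithLp.ofLp h
    simp only [WithLp.ofLp_sum, WithLp.ofLp_smul] at h2
    refine h2.symm.trans ?_
    refine Finset.sum_congr rfl fun k _ => ?_
    congr 1
    simp [EuclideanSpace.inner_eq_star_dotProduct, dotProduct_comm]
  have hAz : A *ᵥ z = ∑ k, (hA.eigenvalues k * ((hA.eigenvectorBasis k).ofLp ⬝ᵥ z)) • (hA.eigenvectorBasis k).ofLp := by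
    conv_lhs => rw [hz]
    rw [Matrix.mulVec_sum]
    refine Finset.sum_congr rfl fun k _ => ?_
    rw [Matrix.mulVec_smul, hA.mulVec_eigenvectorBasis, smul_smul, mul_comm]
  rw [hAz, dotProduct_sum]
  refine Finset.sum_congr rfl fun k _ => ?_
  rw [dotProduct_smul, dotProduct_comm z, smul_eq_mul]
  ring

lemma symm_dot {n : ℕ} {A : Matrix (Fin n) (Fin n) ℝ} (hA : ∀ i j, A i j = A j i) (v w : Fin n → ℝ) :
    v ⬝ᵥ (A *ᵥ w) = w ⬝ᵥ (A *ᵥ v) := by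
  simp only [dotProduct, mulVec, Finset.mul_sum]
  rw [Finset.sum_comm]
  refine Finset.sum_congr rfl fun i _ => Finset.sum_congr rfl fun j _ => ?_
  rw [hA]; ring

lemma isHerm {n : ℕ} {A : Matrix (Fin n) (Fin n) ℝ} (hA : ∀ i j, A i j = A j i) : A.IsHermitian := by
  ext i j
  simp [hA i j]

/-- Reverse Cauchy-Schwarz. -/
lemma rcs {n : ℕ} {A : Matrix (Fin n) (Fin n) ℝ} (hA : ∀ i j, A i j = A j i) (u w : Fin n → ℝ)
    (hu : ∀ z, u ⬝ᵥ z = 0 → z ⬝ᵥ (A *ᵥ z) ≤ 0) (hw : 0 < w ⬝ᵥ (A *ᵥ w)) (v : Fin n → ℝ) :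
    (v ⬝ᵥ (A *ᵥ v)) * (w ⬝ᵥ (A *ᵥ w)) ≤ (v ⬝ᵥ (A *ᵥ w)) ^ 2 := by
  set a := u ⬝ᵥ w with ha
  set b := u ⬝ᵥ v with hb
  have ha0 : a ≠ 0 := fun h => absurd (hu w h) (not_le.mpr hw)
  have h := hu (a • v - b • w) (by
    simp only [dotProduct_sub, dotProduct_smul, smul_eq_mul]
    rw [← ha, ← hb]; ring)
  have e : (a • v - b • w) ⬝ᵥ (A *ᵥ (a • v - b • w)) =
      a ^ 2 * (v ⬝ᵥ (A *ᵥ v)) - 2 * a * b * (v ⬝ᵥ (A *ᵥ w)) + b ^ 2 * (w ⬝ᵥ (A *ᵥ w)) := by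
    simp only [mulVec_sub, mulVec_smul, dotProduct_sub, sub_dotProduct, dotProduct_smul,
      smul_dotProduct, smul_eq_mul]
    rw [symm_dot hA w v]; ring
  rw [e] at h
  set p := v ⬝ᵥ (A *ᵥ v)
  set q := v ⬝ᵥ (A *ᵥ w)
  set r := w ⬝ᵥ (A *ᵥ w)
  have ha2 : 0 < a ^ 2 := by positivity
  have : a ^ 2 * (p * r) ≤ a ^ 2 * q ^ 2 := by
    nlinarith [mul_nonpos_of_nonpos_of_nonneg h hw.le, sq_nonneg (a * q - b * r)]
  exact le_of_mul_le_mul_left this ha2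

lemma bochner {n : ℕ} {H : Matrix (Fin n) (Fin n) ℝ} (hH : ∀ i j, H i j = H j i)
    (hpos : ∀ i j, 0 < H i j) (w : Fin n → ℝ) (hw : ∀ i, 0 < w i)
    (hb : ∀ v, v ⬝ᵥ (H *ᵥ v) ≤ ∑ i, w i / (H *ᵥ w) i * (H *ᵥ v) i ^ 2)
    (z : Fin n → ℝ) (hz : (H *ᵥ w) ⬝ᵥ z = 0) : z ⬝ᵥ (H *ᵥ z) ≤ 0 := by
  set p := H *ᵥ w with hp
  have hp0 : ∀ i, 0 < p i := fun i => by
    rw [hp]; simp only [mulVec, dotProduct]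
    exact Finset.sum_pos (fun j _ => mul_pos (hpos i j) (hw j)) ⟨i, Finset.mem_univ _⟩
  obtain ⟨s, hs⟩ : ∃ s : Fin n → ℝ, ∀ i, 0 < s i ∧ s i ^ 2 = p i / w i :=
    ⟨fun i => √(p i / w i), fun i => ⟨Real.sqrt_pos.2 (div_pos (hp0 i) (hw i)),
      Real.sq_sqrt (div_pos (hp0 i) (hw i)).le⟩⟩
  have hs0 : ∀ i, s i ≠ 0 := fun i => (hs i).1.ne'
  have hw0 : ∀ i, w i ≠ 0 := fun i => (hw i).ne'
  set B : Matrix (Fin n) (Fin n) ℝ := Matrix.of fun i j => H i j / (s i * s j) with hB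
  have hBs : ∀ i j, B i j = B j i := fun i j => by
    simp only [hB, of_apply]; rw [hH, mul_comm (s i)]
  have hBh := isHerm hBs
  have hBH : ∀ (y : Fin n → ℝ) i, (B *ᵥ (fun j => s j * y j)) i = (H *ᵥ y) i / s i := by
    intro y i
    simp only [mulVec, dotProduct, hB, of_apply, Finset.sum_div]
    refine Finset.sum_congr rfl fun j _ => ?_
    have := hs0 i; have := hs0 j
    field_simp
  have hq : z ⬝ᵥ (H *ᵥ z) = (fun j => s j * z j) ⬝ᵥ (B *ᵥ (fun j => s j * z j)) := by
    simp only [dotProduct]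
    refine Finset.sum_congr rfl fun j _ => ?_
    rw [hBH]
    have := hs0 j
    field_simp
  rw [hq, quad_spectral B hBh]
  refine Finset.sum_nonpos fun k _ => ?_
  set l := hBh.eigenvalues k with hl
  set u := (hBh.eigenvectorBasis k).ofLp with hu
  by_cases hl0 : l ≤ 0
  · exact mul_nonpos_of_nonpos_of_nonneg hl0 (sq_nonneg _)
  push Not at hl0
  have heig : B *ᵥ u = l • u := hBh.mulVec_eigenvectorBasis k
  set v : Fin n → ℝ := fun i => u i / s i with hv
  have huv : u = fun i => s i * v i := by
    ext i; have := hs0 i; simp only [hv]; field_simp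
  have hHv : ∀ i, (H *ᵥ v) i = l * (p i / w i) * v i := by
    intro i
    have h1 := hBH v i
    rw [← huv, heig] at h1
    have := hs0 i
    rw [← (hs i).2]
    simp only [Pi.smul_apply, smul_eq_mul, huv] at h1
    field_simp at h1
    linarith
  have hune : u ≠ 0 := by
    intro h
    have h1 := hBh.eigenvectorBasis.orthonormal.ne_zero k
    apply h1
    ext i
    exact congrFun h i
  set N := ∑ i, p i / w i * v i ^ 2 with hN
  have hN0 : 0 < N := by
    obtain ⟨i, hi⟩ := Function.ne_iff.1 hune
    refine Finset.sum_pos' (fun j _ => mul_nonneg (div_pos (hp0 j) (hw j)).le (sq_nonneg _)) ⟨i, Finset.mem_univ _, ?_⟩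
    have : v i ≠ 0 := div_ne_zero hi (hs0 i)
    have := div_pos (hp0 i) (hw i)
    positivity
  have hvHv : v ⬝ᵥ (H *ᵥ v) = l * N := by
    simp only [dotProduct, hHv, hN, Finset.mul_sum]
    exact Finset.sum_congr rfl fun j _ => by ring
  have h1 := hb v
  have hR : ∑ i, w i / p i * (H *ᵥ v) i ^ 2 = l ^ 2 * N := by
    simp only [hHv, hN, Finset.mul_sum]
    refine Finset.sum_congr rfl fun j _ => ?_
    have := hw0 j; have := (hp0 j).ne'
    field_simp
  rw [hvHv, hR] at h1
  have hl1 : 1 ≤ l := by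
    by_contra hlt
    push Not at hlt
    nlinarith [mul_pos hl0 hN0]
  have hS : ∑ i, ∑ j, H i j * w i * w j * (v i / w i - v j / w j) ^ 2 = 2 * N - 2 * (l * N) := by
    have e1 : ∑ i, ∑ j, H i j * w j / w i * v i ^ 2 = N := by
      rw [hN]
      refine Finset.sum_congr rfl fun i _ => ?_
      rw [hp]
      simp only [mulVec, dotProduct, Finset.sum_div, Finset.sum_mul]
    have e2 : ∑ i, ∑ j, H i j * w i / w j * v j ^ 2 = N := by
      rw [Finset.sum_comm, ← e1]
      refine Finset.sum_congr rfl fun i _ => Finset.sum_congr rfl fun j _ => ?_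
      rw [hH]
    have e3 : ∑ i, ∑ j, v i * (H i j * v j) = l * N := by
      rw [← hvHv]; simp only [mulVec, dotProduct, Finset.mul_sum]
    rw [← e3, two_mul]
    nth_rewrite 1 [← e1]
    rw [← e2, Finset.mul_sum, ← Finset.sum_add_distrib, ← Finset.sum_sub_distrib]
    refine Finset.sum_congr rfl fun i _ => ?_
    rw [Finset.mul_sum, ← Finset.sum_add_distrib, ← Finset.sum_sub_distrib]
    refine Finset.sum_congr rfl fun j _ => ?_
    have := hw0 i; have := hw0 j
    field_simp
    ring
  have hnn : ∀ i j, 0 ≤ H i j * w i * w j * (v i / w i - v j / w j) ^ 2 := fun i j =>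
    mul_nonneg (mul_nonneg (mul_nonneg (hpos i j).le (hw i).le) (hw j).le) (sq_nonneg _)
  have hS0 : ∑ i, ∑ j, H i j * w i * w j * (v i / w i - v j / w j) ^ 2 = 0 := by
    apply le_antisymm
    · rw [hS]; nlinarith
    · exact Finset.sum_nonneg fun i _ => Finset.sum_nonneg fun j _ => hnn i j
  have heq : ∀ i j, v i / w i = v j / w j := by
    intro i j
    have h2 := (Finset.sum_eq_zero_iff_of_nonneg (fun i _ => Finset.sum_nonneg fun j _ => hnn i j)).1 hS0 i (Finset.mem_univ _)
    have h3 := (Finset.sum_eq_zero_iff_of_nonneg (fun j _ => hnn i j)).1 h2 j (Finset.mem_univ _)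
    have h4 : H i j * w i * w j ≠ 0 := (mul_pos (mul_pos (hpos i j) (hw i)) (hw j)).ne'
    have h5 := (mul_eq_zero.1 h3).resolve_left h4
    have h6 := pow_eq_zero_iff (two_ne_zero) |>.1 h5
    linarith
  have hdot : u ⬝ᵥ (fun j => s j * z j) = 0 := by
    rcases isEmpty_or_nonempty (Fin n) with he | ⟨⟨i0⟩⟩
    · simp [dotProduct]
    have : u ⬝ᵥ (fun j => s j * z j) = (v i0 / w i0) * (p ⬝ᵥ z) := by
      rw [huv]
      simp only [dotProduct, Finset.mul_sum]
      refine Finset.sum_congr rfl fun j _ => ?_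
      rw [heq i0 j]
      have := (hs j).2
      calc s j * v j * (s j * z j) = s j ^ 2 * v j * z j := by ring
        _ = _ := by rw [this]; ring
    rw [this, hz, mul_zero]
  rw [hdot]; simp

lemma pderiv_swap {n : ℕ} (i j : Fin n) (f : MvPolynomial (Fin n) ℝ) :
    pderiv i (pderiv j f) = pderiv j (pderiv i f) := by
  ext m
  simp only [coeff_pderiv]
  rw [add_right_comm]
  by_cases h : i = j
  · subst h; rfl
  · simp only [Finsupp.add_apply, Finsupp.single_apply, h, Ne.symm h, if_false]
    push_cast
    ring

lemma iter_comm {n : ℕ} (i j : Fin n) (m : ℕ) (f : MvPolynomial (Fin n) ℝ) :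
    (fun h => pderiv j h)^[m] (pderiv i f) = pderiv i ((fun h => pderiv j h)^[m] f) := by
  have h : Function.Commute (fun h : MvPolynomial (Fin n) ℝ => pderiv j h)
      (fun h : MvPolynomial (Fin n) ℝ => pderiv i h) := fun g => pderiv_swap j i g
  exact (h.iterate_left m) f

lemma foldr_comm {n : ℕ} (l : List (Fin n)) (α : Fin n → ℕ) (i : Fin n) (f : MvPolynomial (Fin n) ℝ) :
    l.foldr (fun i g => (fun h => pderiv i h)^[α i] g) (pderiv i f) =
      pderiv i (l.foldr (fun i g => (fun h => pderiv i h)^[α i] g) f) := by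
  induction l with
  | nil => rfl
  | cons a l ih => simp only [List.foldr_cons]; rw [ih, iter_comm]

lemma pd_pderiv {n : ℕ} (α : Fin n → ℕ) (i : Fin n) (f : MvPolynomial (Fin n) ℝ) :
    pd α (pderiv i f) = pderiv i (pd α f) := foldr_comm _ _ _ _

lemma foldr_add {n : ℕ} (l : List (Fin n)) (hl : l.Nodup) (α : Fin n → ℕ) (i : Fin n)
    (f : MvPolynomial (Fin n) ℝ) :
    l.foldr (fun k g => (fun h => pderiv k h)^[(α + Pi.single i 1 : Fin n → ℕ) k] g) f =
      if i ∈ l then pderiv i (l.foldr (fun i g => (fun h => pderiv i h)^[α i] g) f)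
      else l.foldr (fun i g => (fun h => pderiv i h)^[α i] g) f := by
  induction l with
  | nil => simp
  | cons a l ih =>
    rw [List.nodup_cons] at hl
    simp only [List.foldr_cons]
    rw [ih hl.2]
    by_cases h : i = a
    · subst h
      simp only [hl.1, if_false, List.mem_cons, true_or, if_true, Pi.add_apply, Pi.single_eq_same]
      rw [Function.iterate_succ_apply']
    · have h2 : (α + Pi.single i 1 : Fin n → ℕ) a = α a := by simp [Ne.symm h]
      rw [h2]
      by_cases h3 : i ∈ l
      · simp only [h3, if_true, List.mem_cons, or_true]; rw [iter_comm]
      · simp only [h3, h, if_false, List.mem_cons, or_self]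

lemma pd_add_single {n : ℕ} (α : Fin n → ℕ) (i : Fin n) (f : MvPolynomial (Fin n) ℝ) :
    pd (α + Pi.single i 1) f = pderiv i (pd α f) := by
  have := foldr_add (List.finRange n) (List.nodup_finRange n) α i f
  simpa [pd] using this

lemma pd_zero {n : ℕ} (f : MvPolynomial (Fin n) ℝ) : pd 0 f = f := by
  unfold pd
  induction List.finRange n with
  | nil => rfl
  | cons a l ih => simpa using ih

lemma pd_ind {n : ℕ} {P : ℕ → MvPolynomial (Fin n) ℝ → Prop} (f : MvPolynomial (Fin n) ℝ)
    (h0 : P 0 f) (hs : ∀ m g i, P m g → P (m + 1) (pderiv i g)) (α : Fin n → ℕ) :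
    P (∑ i, α i) (pd α f) := by
  generalize hm : ∑ i, α i = m
  induction m generalizing α with
  | zero =>
    have : α = 0 := by
      ext i
      exact Finset.sum_eq_zero_iff.1 hm i (Finset.mem_univ _)
    rw [this, pd_zero]; exact h0
  | succ m ih =>
    obtain ⟨i, hi⟩ : ∃ i, α i ≠ 0 := by
      by_contra h
      push Not at h
      simp [h] at hm
    have e : α = (α - Pi.single i 1) + Pi.single i 1 := by
      ext k
      by_cases hk : k = i
      · subst hk; simp; omega
      · simp [hk]
    rw [e, pd_add_single]
    apply hs
    apply ih
    have := hm
    rw [e] at this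
    simp only [Pi.add_apply, Finset.sum_add_distrib, Finset.sum_pi_single', Finset.mem_univ, if_true] at this
    exact Nat.succ_injective this

lemma pd_linear {n : ℕ} (α : Fin n → ℕ) :
    ∃ L : MvPolynomial (Fin n) ℝ →ₗ[ℝ] MvPolynomial (Fin n) ℝ, ∀ f, pd α f = L f := by
  unfold pd
  induction List.finRange n with
  | nil => exact ⟨LinearMap.id, fun f => rfl⟩
  | cons a l ih =>
    obtain ⟨L, hL⟩ := ih
    refine ⟨((pderiv a).toLinearMap ^ α a) ∘ₗ L, fun f => ?_⟩
    rw [List.foldr_cons, hL, LinearMap.comp_apply, Module.End.pow_apply]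
    rfl

lemma hom_zero_const {n : ℕ} {f : MvPolynomial (Fin n) ℝ} (h : f.IsHomogeneous 0) :
    ∃ c, f = C c := by
  rw [← totalDegree_zero_iff_isHomogeneous, totalDegree_eq_zero_iff_eq_C] at h
  exact ⟨_, h⟩

lemma pd_hom {n d : ℕ} {f : MvPolynomial (Fin n) ℝ} (hf : f.IsHomogeneous d) (α : Fin n → ℕ)
    (h : d < ∑ i, α i) : pd α f = 0 := by
  refine (pd_ind (P := fun m g => (m ≤ d → g.IsHomogeneous (d - m)) ∧ (d < m → g = 0)) f
    ⟨fun _ => hf, fun h => absurd h (by omega)⟩ ?_ α).2 h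
  rintro m g i ⟨h1, h2⟩
  refine ⟨fun hm => ?_, fun hm => ?_⟩
  · have := (h1 (by omega)).pderiv (i := i)
    rwa [Nat.sub_sub] at this
  · rcases Nat.lt_or_ge d m with h3 | h3
    · rw [h2 h3, map_zero]
    · have h4 := h1 h3
      have : d - m = 0 := by omega
      rw [this] at h4
      obtain ⟨c, rfl⟩ := hom_zero_const h4
      exact pderiv_C

lemma pd_coeff_nonneg {n : ℕ} {f : MvPolynomial (Fin n) ℝ} (hf : ∀ m, 0 ≤ f.coeff m) (α : Fin n → ℕ) :
    ∀ m, 0 ≤ (pd α f).coeff m := by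
  refine pd_ind (P := fun _ g => ∀ m, 0 ≤ g.coeff m) f hf ?_ α
  intro _ g i hg m
  rw [coeff_pderiv]
  exact mul_nonneg (hg _) (by positivity)

lemma eval_nonneg' {n : ℕ} {f : MvPolynomial (Fin n) ℝ} (hf : ∀ m, 0 ≤ f.coeff m) (x : Fin n → ℝ)
    (hx : ∀ t, 0 ≤ x t) : 0 ≤ eval x f := by
  rw [eval_eq]
  exact Finset.sum_nonneg fun m _ => mul_nonneg (hf m) (Finset.prod_nonneg fun i _ => pow_nonneg (hx i) _)

lemma PPos.nonneg {n d : ℕ} {f : MvPolynomial (Fin n) ℝ} (hf : f ∈ PPos n d) (m : Fin n →₀ ℕ) :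
    0 ≤ f.coeff m := by
  by_cases h : f.coeff m = 0
  · exact h.ge
  · refine (hf.2 m ?_).le
    have := hf.1 h
    rw [← this, Finsupp.weight_apply, Finsupp.sum_fintype _ _ (by simp)]
    simp

lemma PPos.eval_pos {n d : ℕ} (i0 : Fin n) {f : MvPolynomial (Fin n) ℝ} (hf : f ∈ PPos n d)
    (x : Fin n → ℝ) (hx : ∀ t, 0 < x t) : 0 < eval x f := by
  rw [eval_eq]
  have hc : 0 < f.coeff (Finsupp.single i0 d) := hf.2 _ (by simp [Finsupp.single_apply])
  refine Finset.sum_pos' (fun m _ => mul_nonneg (PPos.nonneg hf m)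
    (Finset.prod_nonneg fun i _ => pow_nonneg (hx i).le _))
    ⟨Finsupp.single i0 d, mem_support_iff.2 hc.ne', ?_⟩
  exact mul_pos hc (Finset.prod_pos fun i _ => pow_pos (hx i) _)

lemma PPos.pderiv {n d : ℕ} {f : MvPolynomial (Fin n) ℝ} (hf : f ∈ PPos n (d + 1)) (i : Fin n) :
    MvPolynomial.pderiv i f ∈ PPos n d := by
  refine ⟨hf.1.pderiv, fun m hm => ?_⟩
  rw [coeff_pderiv]
  refine mul_pos (hf.2 _ ?_) (by positivity)
  simp [Finset.sum_add_distrib, hm, Finsupp.single_apply]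

/-- Uniform version of strict Lorentzian. -/
def SL (n d : ℕ) (g : MvPolynomial (Fin n) ℝ) : Prop :=
  g ∈ PPos n d ∧ ∀ β : Fin n → ℕ, (∑ i, β i) + 2 = d → pd β g ∈ StrictLor2 n

lemma SL.of {n d : ℕ} {f : MvPolynomial (Fin n) ℝ} (hf : f ∈ StrictLor n d) : SL n d f := by
  unfold StrictLor at hf
  split_ifs at hf with h
  · exact ⟨hf, fun β hβ => by omega⟩
  · exact ⟨hf.1, fun β hβ => hf.2 β (by omega)⟩

lemma SL.pderiv {n d : ℕ} {f : MvPolynomial (Fin n) ℝ} (hf : SL n (d + 1) f) (i : Fin n) :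
    SL n d (MvPolynomial.pderiv i f) := by
  refine ⟨PPos.pderiv hf.1 i, fun β hβ => ?_⟩
  rw [pd_pderiv, ← pd_add_single]
  apply hf.2
  simp [Finset.sum_add_distrib]
  omega

lemma SL.pd {n d : ℕ} {f : MvPolynomial (Fin n) ℝ} (hf : SL n d f) (α : Fin n → ℕ)
    (h : ∑ i, α i ≤ d) : SL n (d - ∑ i, α i) (pd α f) := by
  refine pd_ind (P := fun m g => m ≤ d → SL n (d - m) g) f (fun _ => hf) ?_ α h
  intro m g i hg hm
  apply SL.pderiv
  have := hg (by omega)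
  rwa [show d - (m + 1) + 1 = d - m by omega]

lemma euler {n d : ℕ} {g : MvPolynomial (Fin n) ℝ} (hg : g.IsHomogeneous d) (x : Fin n → ℝ) :
    ∑ i, x i * eval x (pderiv i g) = d * eval x g := by
  have := congrArg (eval x) hg.sum_X_mul_pderiv
  simpa using this

lemma hess_apply {n : ℕ} (g : MvPolynomial (Fin n) ℝ) (x : Fin n → ℝ) (i j : Fin n) :
    hess g x i j = eval x (pderiv i (pderiv j g)) := rfl

lemma hess_symm {n : ℕ} (g : MvPolynomial (Fin n) ℝ) (x : Fin n → ℝ) (i j : Fin n) :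
    hess g x i j = hess g x j i := by
  simp only [hess, of_apply]; rw [pderiv_swap]

lemma hess_mulVec {n d : ℕ} {g : MvPolynomial (Fin n) ℝ} (hg : g.IsHomogeneous (d + 1)) (x : Fin n → ℝ)
    (i : Fin n) : (hess g x *ᵥ x) i = d * eval x (pderiv i g) := by
  rw [← euler (by simpa using hg.pderiv (i := i)) x]
  simp only [mulVec, dotProduct, hess, of_apply]
  refine Finset.sum_congr rfl fun j _ => ?_
  rw [pderiv_swap, mul_comm]

lemma base_case {n : ℕ} {M : Matrix (Fin n) (Fin n) ℝ} (h : posEigCount M = 1) :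
    ∃ u : Fin n → ℝ, ∀ z, u ⬝ᵥ z = 0 → z ⬝ᵥ (M *ᵥ z) ≤ 0 := by
  unfold posEigCount at h
  split_ifs at h with hM
  obtain ⟨k, hk⟩ := Set.ncard_eq_one.1 h
  refine ⟨(hM.eigenvectorBasis k).ofLp, fun z hz => ?_⟩
  rw [quad_spectral M hM]
  refine Finset.sum_nonpos fun j _ => ?_
  by_cases hj : j = k
  · subst hj; rw [hz]; simp
  · have : j ∉ {i | 0 < hM.eigenvalues i} := by rw [hk]; exact hj
    exact mul_nonpos_of_nonpos_of_nonneg (not_lt.1 this) (sq_nonneg _)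

theorem hodge_riemann {n : ℕ} (i0 : Fin n) (k : ℕ) (g : MvPolynomial (Fin n) ℝ) (hg : SL n (k + 2) g)
    (w : Fin n → ℝ) (hw : ∀ i, 0 < w i) (v : Fin n → ℝ) :
    (v ⬝ᵥ (hess g w *ᵥ v)) * (w ⬝ᵥ (hess g w *ᵥ w)) ≤ (v ⬝ᵥ (hess g w *ᵥ w)) ^ 2 := by
  induction k generalizing g v with
  | zero =>
    have hpos : ∀ i j, 0 < hess g w i j := fun i j =>
      PPos.eval_pos i0 (PPos.pderiv (PPos.pderiv hg.1 j) i) w hw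
    have hwp : 0 < w ⬝ᵥ (hess g w *ᵥ w) := Finset.sum_pos (fun i _ => mul_pos (hw i)
      (Finset.sum_pos (fun j _ => mul_pos (hpos i j) (hw j)) ⟨i0, Finset.mem_univ _⟩)) ⟨i0, Finset.mem_univ _⟩
    have hc : hess g w = hess g 0 := by
      ext i j
      simp only [hess, of_apply]
      obtain ⟨c, hc⟩ := hom_zero_const (PPos.pderiv (PPos.pderiv hg.1 j) i).1
      rw [hc, eval_C, eval_C]
    have h2 := hg.2 0 (by simp)
    rw [pd_zero] at h2
    obtain ⟨u, hu⟩ := base_case h2.2.2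
    rw [← hc] at hu
    exact rcs (hess_symm g w) u w hu hwp v
  | succ k ih =>
    have hpos : ∀ i j, 0 < hess g w i j := fun i j =>
      PPos.eval_pos i0 (PPos.pderiv (PPos.pderiv hg.1 j) i) w hw
    have hpp : ∀ i, 0 < (hess g w *ᵥ w) i := fun i =>
      Finset.sum_pos (fun j _ => mul_pos (hpos i j) (hw j)) ⟨i0, Finset.mem_univ _⟩
    have hwp : 0 < w ⬝ᵥ (hess g w *ᵥ w) := Finset.sum_pos (fun i _ => mul_pos (hw i) (hpp i)) ⟨i0, Finset.mem_univ _⟩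
    refine rcs (hess_symm g w) (hess g w *ᵥ w) w ?_ hwp v
    refine bochner (hess_symm g w) hpos w hw fun v => ?_
    have hk : (0 : ℝ) < k + 1 := by positivity
    have hvw : ∀ (v : Fin n → ℝ) i, v ⬝ᵥ (hess (pderiv i g) w *ᵥ w) = (k + 1) * (hess g w *ᵥ v) i := by
      intro v i
      have h1 : (pderiv i g).IsHomogeneous ((k + 1) + 1) := (PPos.pderiv hg.1 i).1
      simp only [dotProduct, hess_mulVec h1]
      simp only [mulVec, dotProduct, Finset.mul_sum]
      refine Finset.sum_congr rfl fun j _ => ?_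
      rw [hess_symm]
      simp only [hess, of_apply]
      push_cast; ring
    have hsum : ∑ i, w i * (v ⬝ᵥ (hess (pderiv i g) w *ᵥ v)) = (k + 1) * (v ⬝ᵥ (hess g w *ᵥ v)) := by
      have e : ∀ a b, ∑ i, w i * hess (pderiv i g) w a b = (k + 1) * hess g w a b := by
        intro a b
        have h1 : (pderiv a (pderiv b g)).IsHomogeneous (k + 1) := (PPos.pderiv (PPos.pderiv hg.1 b) a).1
        have h2 := euler h1 w
        simp only [hess, of_apply]
        push_cast at h2
        rw [← h2]
        refine Finset.sum_congr rfl fun i _ => ?_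
        rw [pderiv_swap b i, pderiv_swap a i]
      simp only [dotProduct, mulVec, Finset.mul_sum]
      rw [Finset.sum_comm]
      refine Finset.sum_congr rfl fun a _ => ?_
      rw [Finset.sum_comm]
      refine Finset.sum_congr rfl fun b _ => ?_
      calc _ = (∑ i, w i * hess (pderiv i g) w a b) * (v a * v b) := by
            rw [Finset.sum_mul]; exact Finset.sum_congr rfl fun i _ => by ring
        _ = _ := by rw [e]; ring
    have hle : ∑ i, w i * (v ⬝ᵥ (hess (pderiv i g) w *ᵥ v)) ≤
        ∑ i, w i * ((k + 1) * ((hess g w *ᵥ v) i ^ 2 / (hess g w *ᵥ w) i)) := by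
      refine Finset.sum_le_sum fun i _ => mul_le_mul_of_nonneg_left ?_ (hw i).le
      have h1 := ih (pderiv i g) (SL.pderiv hg i) v
      rw [hvw v i, hvw w i] at h1
      rw [← mul_div_assoc, le_div_iff₀ (hpp i)]
      refine le_of_mul_le_mul_left ?_ hk
      linarith
    rw [hsum] at hle
    refine le_of_mul_le_mul_left (hle.trans_eq ?_) hk
    rw [Finset.mul_sum]
    exact Finset.sum_congr rfl fun i _ => by ring

lemma rayleigh_arith (a b x F p q k : ℝ) (ha : 0 < a) (hb : 0 < b) (hF : 0 < F)
    (hp : 0 < p) (hq : 0 < q) (hk : 0 ≤ k)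
    (h : (a ^ 2 * p + 2 * a * b * x + b ^ 2 * q) * ((k + 1) * ((k + 2) * F)) ≤
      ((k + 1) * (2 * a * b)) ^ 2) : F * x * (k + 2) ≤ 2 * (k + 1) * b * a := by
  have h2 : 2 * a * b * x * ((k + 1) * ((k + 2) * F)) ≤ ((k + 1) * (2 * a * b)) ^ 2 := by
    refine le_trans (mul_le_mul_of_nonneg_right ?_ (by positivity)) h
    have : 0 ≤ a ^ 2 * p := by positivity
    have : 0 ≤ b ^ 2 * q := by positivity
    linarith
  have h3 : 0 < 2 * a * b * (k + 1) := by positivity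
  refine le_of_mul_le_mul_left ?_ h3
  linarith

lemma hess_quad {n k : ℕ} {g : MvPolynomial (Fin n) ℝ} (hg : g.IsHomogeneous (k + 1 + 1))
    (w : Fin n → ℝ) :
    w ⬝ᵥ (hess g w *ᵥ w) = ((k + 1 : ℕ) : ℝ) * (((k + 1 + 1 : ℕ) : ℝ) * eval w g) := by
  rw [← euler hg w, Finset.mul_sum]
  unfold dotProduct
  refine Finset.sum_congr rfl fun l _ => ?_
  rw [hess_mulVec hg]
  ring

lemma lin_two {n : ℕ} (y : Fin n → ℝ) (a b : ℝ) (i j : Fin n) :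
    (a • Pi.single i 1 + b • Pi.single j 1) ⬝ᵥ y = a * y i + b * y j := by
  simp only [add_dotProduct, smul_dotProduct, single_dotProduct, smul_eq_mul, one_mul]

lemma quad_two {n : ℕ} {A : Matrix (Fin n) (Fin n) ℝ} (hA : ∀ i j, A i j = A j i) (a b : ℝ)
    (i j : Fin n) :
    (a • Pi.single i 1 + b • Pi.single j 1) ⬝ᵥ (A *ᵥ (a • Pi.single i 1 + b • Pi.single j 1)) =
      a ^ 2 * A i i + 2 * a * b * A i j + b ^ 2 * A j j := by
  simp only [add_dotProduct, smul_dotProduct, mulVec_add, mulVec_smul, dotProduct_add,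
    dotProduct_smul, single_dotProduct, smul_eq_mul, one_mul, mulVec_single, col_apply,
    MulOpposite.op_one, one_smul]
  rw [hA j i]; ring

lemma rayleigh_pos {n : ℕ} (k : ℕ) (g : MvPolynomial (Fin n) ℝ) (hg : SL n (k + 2) g)
    (w : Fin n → ℝ) (hw : ∀ i, 0 < w i) (i j : Fin n) :
    eval w g * eval w (pderiv j (pderiv i g)) * (k + 2) ≤
      2 * (k + 1) * eval w (pderiv i g) * eval w (pderiv j g) := by
  have hpos : ∀ i j, 0 < hess g w i j := fun a b => by
    rw [hess_apply]
    exact PPos.eval_pos i (PPos.pderiv (PPos.pderiv hg.1 b) a) w hw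
  have ha0 : 0 < eval w (pderiv j g) := PPos.eval_pos i (PPos.pderiv hg.1 j) w hw
  have hb0 : 0 < eval w (pderiv i g) := PPos.eval_pos i (PPos.pderiv hg.1 i) w hw
  have hf0 : 0 < eval w g := PPos.eval_pos i hg.1 w hw
  obtain ⟨a, ha⟩ : ∃ a, a = eval w (pderiv j g) := ⟨_, rfl⟩
  obtain ⟨b, hb⟩ : ∃ b, b = eval w (pderiv i g) := ⟨_, rfl⟩
  rw [← ha] at ha0
  rw [← hb] at hb0
  have h := hodge_riemann i k g hg w hw (a • Pi.single i 1 + b • Pi.single j 1)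
  have hhom : g.IsHomogeneous ((k + 1) + 1) := hg.1.1
  have e1 := hess_quad hhom w
  have e2 := lin_two (hess g w *ᵥ w) a b i j
  rw [hess_mulVec hhom, hess_mulVec hhom, ← ha, ← hb] at e2
  have e3 := quad_two (hess_symm g w) a b i j
  rw [e1, e2, e3] at h
  have hij : eval w (pderiv j (pderiv i g)) = hess g w i j := by
    rw [hess_apply, pderiv_swap]
  rw [hij, ← ha, ← hb]
  refine rayleigh_arith a b _ _ _ _ k ha0 hb0 hf0 (hpos i i) (hpos j j) (Nat.cast_nonneg k) ?_
  have c1 : ((k + 1 : ℕ) : ℝ) = k + 1 := by push_cast; ring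
  have c2 : ((k + 1 + 1 : ℕ) : ℝ) = k + 2 := by push_cast; ring
  rw [c1, c2] at h
  refine h.trans_eq ?_
  ring

lemma rayleigh_strict {n d : ℕ} (hd : 1 ≤ d) {f : MvPolynomial (Fin n) ℝ} (hf : SL n d f)
    (α : Fin n → ℕ) (i j : Fin n) (x : Fin n → ℝ) (hx : ∀ t, 0 < x t) :
    eval x (pd α f) * eval x (pd (α + Pi.single i 1 + Pi.single j 1) f) ≤
      (2 * (1 - 1 / (d : ℝ))) * eval x (pd (α + Pi.single i 1) f) * eval x (pd (α + Pi.single j 1) f) := by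
  have hd0 : (1 : ℝ) ≤ d := by exact_mod_cast hd
  have hn : ∀ β, 0 ≤ eval x (pd β f) := fun β =>
    eval_nonneg' (pd_coeff_nonneg (PPos.nonneg hf.1) β) x (fun t => (hx t).le)
  have hc : 0 ≤ 2 * (1 - 1 / (d : ℝ)) := by
    have : 1 / (d : ℝ) ≤ 1 := by rw [div_le_one (by linarith)]; exact hd0
    linarith
  by_cases h : ∑ t, α t + 2 ≤ d
  · obtain ⟨k, hk⟩ := Nat.exists_eq_add_of_le h
    have hg := SL.pd hf α (by omega)
    rw [show d - ∑ t, α t = k + 2 by omega] at hg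
    have := rayleigh_pos k _ hg x hx i j
    simp only [pd_add_single]
    have ha := hn (α + Pi.single i 1)
    have hb := hn (α + Pi.single j 1)
    rw [pd_add_single] at ha hb
    have hk2 : (0 : ℝ) < k + 2 := by positivity
    have hkd : (k : ℝ) + 2 ≤ d := by
      have : k + 2 ≤ d := by omega
      exact_mod_cast this
    have hcc : 2 * (k + 1) / (k + 2) ≤ 2 * (1 - 1 / (d : ℝ)) := by
      have h1 : 1 / (d : ℝ) ≤ 1 / (k + 2) := one_div_le_one_div_of_le hk2 hkd
      have h2 : 2 * ((k : ℝ) + 1) / (k + 2) = 2 * (1 - 1 / (k + 2)) := by field_simp; ring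
      rw [h2]; linarith
    rw [mul_assoc]
    refine le_trans ?_ (mul_le_mul_of_nonneg_right hcc (mul_nonneg ha hb))
    rw [div_mul_eq_mul_div, le_div_iff₀ hk2]
    linarith
  · rw [pd_hom hf.1.1 (α + Pi.single i 1 + Pi.single j 1) (by simp [Finset.sum_add_distrib]; omega)]
    rw [map_zero, mul_zero]
    exact mul_nonneg (mul_nonneg hc (hn _)) (hn _)

lemma rayleigh_strict' {n d : ℕ} (hd : 1 ≤ d) {f : MvPolynomial (Fin n) ℝ} (hf : SL n d f)
    (α : Fin n → ℕ) (i j : Fin n) (x : Fin n → ℝ) (hx : ∀ t, 0 ≤ x t) :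
    eval x (pd α f) * eval x (pd (α + Pi.single i 1 + Pi.single j 1) f) ≤
      (2 * (1 - 1 / (d : ℝ))) * eval x (pd (α + Pi.single i 1) f) * eval x (pd (α + Pi.single j 1) f) := by
  have hcont : ∀ p : MvPolynomial (Fin n) ℝ,
      Filter.Tendsto (fun e : ℝ => eval (fun t => x t + e) p) (nhdsWithin 0 (Set.Ioi 0)) (nhds (eval x p)) := by
    intro p
    have h1 : Continuous (fun e : ℝ => eval (fun t => x t + e) p) :=
      (MvPolynomial.continuous_eval p).comp (by fun_prop)
    have h2 := h1.tendsto 0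
    simp only [add_zero] at h2
    exact h2.mono_left nhdsWithin_le_nhds
  refine le_of_tendsto_of_tendsto ((hcont _).mul (hcont _)) (((hcont _).const_mul _).mul (hcont _)) ?_
  filter_upwards [self_mem_nhdsWithin] with e he
  exact rayleigh_strict hd hf α i j _ (fun t => add_pos_of_nonneg_of_pos (hx t) he)

lemma eval_pd_continuous (n d : ℕ) (α : Fin n → ℕ) (x : Fin n → ℝ) :
    ∃ F : ((Fin n →₀ ℕ) → ℝ) → ℝ, Continuous F ∧
      ∀ f : MvPolynomial (Fin n) ℝ, f.IsHomogeneous d → eval x (pd α f) = F (coeffFun f) := by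
  obtain ⟨L, hL⟩ := pd_linear α
  refine ⟨fun φ => ∑ s ∈ Finset.finsuppAntidiag Finset.univ d, φ s * eval x (L (monomial s 1)), ?_, ?_⟩
  · fun_prop
  · intro f hf
    have hsub : f.support ⊆ Finset.finsuppAntidiag Finset.univ d := by
      intro m hm
      have := hf (mem_support_iff.1 hm)
      rw [Finset.mem_finsuppAntidiag]
      refine ⟨?_, Finset.subset_univ _⟩
      rw [← this, Finsupp.weight_apply, Finsupp.sum_fintype _ _ (by simp)]
      simp
    have hfs : f = ∑ s ∈ Finset.finsuppAntidiag Finset.univ d, f.coeff s • monomial s (1 : ℝ) := by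
      conv_lhs => rw [f.as_sum]
      rw [Finset.sum_subset hsub]
      · refine Finset.sum_congr rfl fun s _ => ?_
        rw [smul_monomial, smul_eq_mul, mul_one]
      · intro s _ hs
        rw [notMem_support_iff.1 hs, monomial_zero]
    rw [hL]
    conv_lhs => rw [hfs]
    simp only [map_sum, map_smul, smul_eval, coeffFun]

end Aux

/-- Every Lorentzian polynomial `f ∈ L_n^d` with `d ≥ 1` is
`2(1 - 1/d)`-Rayleigh. -/
theorem statement1 {n d : ℕ} (hd : 1 ≤ d) (f : MvPolynomial (Fin n) ℝ)
    (hf : f ∈ Lor n d) :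
    IsRayleigh (2 * (1 - 1 / (d : ℝ))) f := by
  obtain ⟨hhom, hcl⟩ := hf
  refine ⟨fun m => ?_, fun α i j x hx => ?_⟩
  · have hC : IsClosed {φ : (Fin n →₀ ℕ) → ℝ | 0 ≤ φ m} :=
      isClosed_le continuous_const (continuous_apply m)
    refine closure_minimal ?_ hC hcl
    rintro _ ⟨g, hg, rfl⟩
    exact PPos.nonneg (SL.of hg).1 m
  · obtain ⟨F1, c1, h1⟩ := eval_pd_continuous n d α x
    obtain ⟨F2, c2, h2⟩ := eval_pd_continuous n d (α + Pi.single i 1 + Pi.single j 1) x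
    obtain ⟨F3, c3, h3⟩ := eval_pd_continuous n d (α + Pi.single i 1) x
    obtain ⟨F4, c4, h4⟩ := eval_pd_continuous n d (α + Pi.single j 1) x
    have hC : IsClosed {φ : (Fin n →₀ ℕ) → ℝ |
        F1 φ * F2 φ ≤ 2 * (1 - 1 / (d : ℝ)) * F3 φ * F4 φ} :=
      isClosed_le (c1.mul c2) ((continuous_const.mul c3).mul c4)
    rw [h1 f hhom, h2 f hhom, h3 f hhom, h4 f hhom]
    refine closure_minimal ?_ hC hcl
    rintro _ ⟨g, hg, rfl⟩
    have hs := SL.of hg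
    have hgh := hs.1.1
    have := rayleigh_strict' hd hs α i j x hx
    rw [h1 g hgh, h2 g hgh, h3 g hgh, h4 g hgh] at this
    exact this

end LorentzianPaper
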